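/- Let A, B ∈ ℂ^{n₁×n₁×n₃} with A ⋆ B = B ⋆ A, let k = max{ind(A), ind(B)}, and let A^{GD} and B^{GD} be GD inverses of A and B satisfying the GD equations with exponent k. If B^{GD} ⋆ B ⋆ A = A ⋆ B^{GD} ⋆ B, then A^{GD} ⋆ B^{GD} is a GD inverse of A ⋆ B with exponent k; that is, (A⋆B) ⋆ (A^{GD}⋆B^{GD}) ⋆ (A⋆B) = A⋆B, (A^{GD}⋆B^{GD}) ⋆ (A⋆B)^{k+1} = (A⋆B)^k, and (A⋆B)^{k+1} ⋆ (A^{GD}⋆B^{GD}) = (A⋆B)^k. -/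

import Mathlib

open Matrix BigOperators

/-- A third-order complex tensor in `ℂ^{n₁ × n₂ × n₃}`, given by its frontal slices. -/
abbrev Tensor3 (n₁ n₂ n₃ : ℕ) := Fin n₃ → Matrix (Fin n₁) (Fin n₂) ℂ

/-- Mode-3 product of a tensor with an `n₃ × n₃` matrix: the slices of the result are the
indicated linear combinations of the slices of `A`. -/
noncomputable def mode3 {n₁ n₂ n₃ : ℕ} (M : Matrix (Fin n₃) (Fin n₃) ℂ) (A : Tensor3 n₁ n₂ n₃) :
    Tensor3 n₁ n₂ n₃ :=
  fun i => ∑ j, M i j • A j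

/-- The M-product `A ⋆_M B`: slice-wise matrix product in the transformed (hat) domain,
transformed back by `M⁻¹`. -/
noncomputable def mprod {n₁ n₂ l n₃ : ℕ} (M : Matrix (Fin n₃) (Fin n₃) ℂ)
    (A : Tensor3 n₁ n₂ n₃) (B : Tensor3 n₂ l n₃) : Tensor3 n₁ l n₃ :=
  mode3 M⁻¹ (fun i => mode3 M A i * mode3 M B i)

/-- The identity tensor: every slice of its mode-3 transform is the identity matrix. -/
noncomputable def idT (n₁ : ℕ) {n₃ : ℕ} (M : Matrix (Fin n₃) (Fin n₃) ℂ) : Tensor3 n₁ n₁ n₃ :=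
  mode3 M⁻¹ (fun _ => (1 : Matrix (Fin n₁) (Fin n₁) ℂ))

/-- Powers of a square tensor with respect to the M-product. -/
noncomputable def mpow {n₁ n₃ : ℕ} (M : Matrix (Fin n₃) (Fin n₃) ℂ) (A : Tensor3 n₁ n₁ n₃) :
    ℕ → Tensor3 n₁ n₁ n₃
  | 0 => idT n₁ M
  | k + 1 => mprod M (mpow M A k) A

/-- Conjugate transpose with respect to the M-product: slice-wise conjugate transpose in the
transformed domain. -/
noncomputable def ctrans {n₁ n₂ n₃ : ℕ} (M : Matrix (Fin n₃) (Fin n₃) ℂ) (A : Tensor3 n₁ n₂ n₃) :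
    Tensor3 n₂ n₁ n₃ :=
  mode3 M⁻¹ (fun i => (mode3 M A i)ᴴ)

/-- Index of a square complex matrix: the least `k ≥ 0` with `rank(B^k) = rank(B^{k+1})`. -/
noncomputable def matIndex {n : ℕ} (B : Matrix (Fin n) (Fin n) ℂ) : ℕ :=
  sInf {k : ℕ | (B ^ k).rank = (B ^ (k + 1)).rank}

/-- Index of a tensor: the maximum of the indices of the slices of its mode-3 transform. -/
noncomputable def tIndex {n₁ n₃ : ℕ} (M : Matrix (Fin n₃) (Fin n₃) ℂ)
    (A : Tensor3 n₁ n₁ n₃) : ℕ :=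
  Finset.univ.sup fun i => matIndex (mode3 M A i)

/-- `X` is a GD inverse of `A` with exponent `k`:
`A ⋆ X ⋆ A = A`, `X ⋆ A^{k+1} = A^k`, `A^{k+1} ⋆ X = A^k`. -/
def IsGD {n₁ n₃ : ℕ} (M : Matrix (Fin n₃) (Fin n₃) ℂ) (A X : Tensor3 n₁ n₁ n₃)
    (k : ℕ) : Prop :=
  mprod M (mprod M A X) A = A ∧
  mprod M X (mpow M A (k + 1)) = mpow M A k ∧
  mprod M (mpow M A (k + 1)) X = mpow M A k

/-- `X` is the Drazin inverse of `A` with exponent `k`. -/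
def IsDrazin {n₁ n₃ : ℕ} (M : Matrix (Fin n₃) (Fin n₃) ℂ) (A X : Tensor3 n₁ n₁ n₃)
    (k : ℕ) : Prop :=
  mprod M X (mpow M A (k + 1)) = mpow M A k ∧
  mprod M (mprod M X A) X = X ∧
  mprod M X A = mprod M A X

/-- `X` is the Moore–Penrose inverse of `A`. -/
def IsMP {n₁ n₃ : ℕ} (M : Matrix (Fin n₃) (Fin n₃) ℂ) (A X : Tensor3 n₁ n₁ n₃) : Prop :=
  mprod M (mprod M A X) A = A ∧
  mprod M (mprod M X A) X = X ∧
  ctrans M (mprod M A X) = mprod M A X ∧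
  ctrans M (mprod M X A) = mprod M X A

theorem mode3_mode3 {n₁ n₂ n₃ : ℕ} (M N : Matrix (Fin n₃) (Fin n₃) ℂ) (A : Tensor3 n₁ n₂ n₃) :
    mode3 M (mode3 N A) = mode3 (M * N) A := by
  funext i
  simp only [mode3, Matrix.mul_apply, Finset.smul_sum, Finset.sum_smul, smul_smul]
  exact Finset.sum_comm

theorem mode3_one {n₁ n₂ n₃ : ℕ} (A : Tensor3 n₁ n₂ n₃) : mode3 1 A = A := by
  funext i
  simp [mode3, Matrix.one_apply]

theorem mode3_mode3_inv {n₁ n₂ n₃ : ℕ} {M : Matrix (Fin n₃) (Fin n₃) ℂ} (hM : IsUnit M)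
    (A : Tensor3 n₁ n₂ n₃) : mode3 M (mode3 M⁻¹ A) = A := by
  rw [mode3_mode3, M.mul_nonsing_inv ((M.isUnit_iff_isUnit_det).mp hM), mode3_one]

theorem mode3_injective {n₁ n₂ n₃ : ℕ} {M : Matrix (Fin n₃) (Fin n₃) ℂ} (hM : IsUnit M) :
    Function.Injective (mode3 M : Tensor3 n₁ n₂ n₃ → Tensor3 n₁ n₂ n₃) := by
  refine Function.LeftInverse.injective (g := mode3 M⁻¹) fun A => ?_
  rw [mode3_mode3, M.nonsing_inv_mul ((M.isUnit_iff_isUnit_det).mp hM), mode3_one]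

theorem mode3_mprod {n₁ n₃ : ℕ} {M : Matrix (Fin n₃) (Fin n₃) ℂ} (hM : IsUnit M)
    (A B : Tensor3 n₁ n₁ n₃) : mode3 M (mprod M A B) = mode3 M A * mode3 M B :=
  mode3_mode3_inv hM _

theorem mode3_mpow {n₁ n₃ : ℕ} {M : Matrix (Fin n₃) (Fin n₃) ℂ} (hM : IsUnit M)
    (A : Tensor3 n₁ n₁ n₃) (k : ℕ) : mode3 M (mpow M A k) = mode3 M A ^ k := by
  induction k with
  | zero => exact mode3_mode3_inv hM _
  | succ k ih => rw [mpow, mode3_mprod hM, ih, pow_succ]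

theorem IsGD.mode3_eqs {n₁ n₃ : ℕ} {M : Matrix (Fin n₃) (Fin n₃) ℂ} (hM : IsUnit M)
    {A X : Tensor3 n₁ n₁ n₃} {k : ℕ} (h : IsGD M A X k) :
    mode3 M A * mode3 M X * mode3 M A = mode3 M A ∧
    mode3 M X * mode3 M A ^ (k + 1) = mode3 M A ^ k ∧
    mode3 M A ^ (k + 1) * mode3 M X = mode3 M A ^ k := by
  obtain ⟨h₁, h₂, h₃⟩ := h
  simpa only [mode3_mprod hM, mode3_mpow hM] using
    And.intro (congrArg (mode3 M) h₁) (And.intro (congrArg (mode3 M) h₂) (congrArg (mode3 M) h₃))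

/-- The forward order law for the GD equations in an arbitrary monoid. -/
theorem forward_order_law_of_commute {R : Type*} [Monoid R] {a b x y : R} {k : ℕ}
    (hc : Commute a b) (ha : a * x * a = a) (hxa : x * a ^ (k + 1) = a ^ k)
    (hax : a ^ (k + 1) * x = a ^ k) (hb : b * y * b = b) (hyb : y * b ^ (k + 1) = b ^ k)
    (hby : b ^ (k + 1) * y = b ^ k) (hy : y * b * a = a * y * b) :
    a * b * (x * y) * (a * b) = a * b ∧
    x * y * (a * b) ^ (k + 1) = (a * b) ^ k ∧
    (a * b) ^ (k + 1) * (x * y) = (a * b) ^ k := by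
  refine ⟨?_, ?_, ?_⟩
  · calc a * b * (x * y) * (a * b) = b * a * (x * y) * (b * a) := by rw [hc.eq]
      _ = b * a * x * (y * b * a) := by simp only [mul_assoc]
      _ = b * (a * x * a) * y * b := by rw [hy]; simp only [mul_assoc]
      _ = a * (b * y * b) := by rw [ha, ← hc.eq]; simp only [mul_assoc]
      _ = a * b := by rw [hb]
  · calc x * y * (a * b) ^ (k + 1) = x * (y * b ^ (k + 1)) * a ^ (k + 1) := by
          rw [hc.mul_pow, (hc.pow_pow _ _).eq]; simp only [mul_assoc]
      _ = x * a ^ (k + 1) * b ^ k := by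
          rw [hyb, mul_assoc, ← (hc.pow_pow _ _).eq, mul_assoc]
      _ = (a * b) ^ k := by rw [hxa, hc.mul_pow]
  · calc (a * b) ^ (k + 1) * (x * y) = b ^ (k + 1) * (a ^ (k + 1) * x) * y := by
          rw [hc.mul_pow, (hc.pow_pow _ _).eq]; simp only [mul_assoc]
      _ = a ^ k * (b ^ (k + 1) * y) := by rw [hax, ← (hc.pow_pow _ _).eq, mul_assoc]
      _ = (a * b) ^ k := by rw [hby, hc.mul_pow]

/-- forward order law for the GD inverse under commutativity `A ⋆ B = B ⋆ A`. -/
theorem gd_forward_order_law {n₁ n₃ : ℕ} (hn₁ : 0 < n₁) (hn₃ : 0 < n₃)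
    (M : Matrix (Fin n₃) (Fin n₃) ℂ) (hM : IsUnit M)
    (A B AGD BGD : Tensor3 n₁ n₁ n₃) (k : ℕ)
    (hcomm : mprod M A B = mprod M B A)
    (hk : k = max (tIndex M A) (tIndex M B))
    (hAGD : IsGD M A AGD k) (hBGD : IsGD M B BGD k)
    (h1 : mprod M (mprod M BGD B) A = mprod M (mprod M A BGD) B) :
    IsGD M (mprod M A B) (mprod M AGD BGD) k := by
  obtain ⟨ha, hxa, hax⟩ := hAGD.mode3_eqs hM
  obtain ⟨hb, hyb, hby⟩ := hBGD.mode3_eqs hM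
  have hc := congrArg (mode3 M) hcomm
  have hy := congrArg (mode3 M) h1
  simp only [mode3_mprod hM] at hc hy
  obtain ⟨e₁, e₂, e₃⟩ := forward_order_law_of_commute hc ha hxa hax hb hyb hby hy
  refine ⟨mode3_injective hM ?_, mode3_injective hM ?_, mode3_injective hM ?_⟩ <;>
    simpa only [mode3_mprod hM, mode3_mpow hM]
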